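/- arXiv:2204.06873 — 5 statements merged into one kernel-verified Lean document; each statement's English description precedes it below -/
import Mathlib

section
/- Let B, A, m, T be real numbers with B > 0, A > 0, m > 0, T > 0, and let x, v, xc, vc, an, as, t : ℕ → ℝ be sequences such that for every k: (i) vc k ≥ 0 and xc k − x k ≥ ((v k)² − (vc k)²)/(2B) (environment test); (ii) −m ≤ an k ≤ A; (iii) as k = an k if xc k − x k ≥ v k·T + A·T²/2 + ((v k + A·T)² − (vc k)²)/(2B), and as k = −B otherwise; (iv) 0 ≤ t k ≤ T; (v) v k + as k·s ≥ 0 for all s ∈ [0, t k]; (vi) x (k+1) = x k + v k·(t k) + as k·(t k)²/2 and v (k+1) = v k + as k·(t k). Then for every k and every s ∈ [0, t k], if x k + v k·s + as k·s²/2 ≥ xc k then v k + as k·s ≤ vc k. -/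
theorem model2_safe (B A m T : ℝ) (hB : 0 < B) (hA : 0 < A) (hm : 0 < m) (hT : 0 < T)
    (x v xc vc an as t : ℕ → ℝ)
    (henv : ∀ k, vc k ≥ 0 ∧ xc k - x k ≥ ((v k) ^ 2 - (vc k) ^ 2) / (2 * B))
    (han : ∀ k, -m ≤ an k ∧ an k ≤ A)
    (hctrl : ∀ k,
      (xc k - x k ≥ v k * T + A * T ^ 2 / 2 + ((v k + A * T) ^ 2 - (vc k) ^ 2) / (2 * B) →
        as k = an k) ∧
      (¬ (xc k - x k ≥ v k * T + A * T ^ 2 / 2 + ((v k + A * T) ^ 2 - (vc k) ^ 2) / (2 * B)) →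
        as k = -B))
    (ht : ∀ k, 0 ≤ t k ∧ t k ≤ T)
    (hvel : ∀ k, ∀ s ∈ Set.Icc (0 : ℝ) (t k), v k + as k * s ≥ 0)
    (hx : ∀ k, x (k + 1) = x k + v k * t k + as k * (t k) ^ 2 / 2)
    (hv : ∀ k, v (k + 1) = v k + as k * t k) :
    ∀ k, ∀ s ∈ Set.Icc (0 : ℝ) (t k),
      x k + v k * s + as k * s ^ 2 / 2 ≥ xc k → v k + as k * s ≤ vc k := by
  intro k s hs hcrit
  obtain ⟨hs0, hst⟩ := hs
  obtain ⟨hvc, hsafe⟩ := henv k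
  have hsT : s ≤ T := hst.trans (ht k).2
  have hv0 : 0 ≤ v k := by
    simpa using hvel k 0 ⟨le_rfl, (ht k).1⟩
  by_cases hacc : xc k - x k ≥
      v k * T + A * T ^ 2 / 2 + ((v k + A * T) ^ 2 - (vc k) ^ 2) / (2 * B)
  · have ha : as k ≤ A := (hctrl k).1 hacc ▸ (han k).2
    have hspeed : as k * s ≤ A * T := by gcongr
    have hdist : v k * s + as k * s ^ 2 / 2 ≤ v k * T + A * T ^ 2 / 2 := by gcongr
    have hquot : ((v k + A * T) ^ 2 - (vc k) ^ 2) / (2 * B) ≤ 0 := by linarith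
    have hsq : (v k + A * T) ^ 2 ≤ (vc k) ^ 2 := by
      rw [div_le_iff₀ (by positivity)] at hquot
      linarith
    linarith [le_of_abs_le (abs_le_of_sq_le_sq hsq hvc)]
  · rw [(hctrl k).2 hacc] at hcrit ⊢
    have hquot : ((v k) ^ 2 - (vc k) ^ 2) / (2 * B) ≤ v k * s + -B * s ^ 2 / 2 := by linarith
    rw [div_le_iff₀ (by positivity)] at hquot
    exact le_of_abs_le (abs_le_of_sq_le_sq (by linarith) hvc)
end

section
/- Let B, A, m, T be real numbers with B > 0, A > 0, m > 0, T > 0, and let x, v, xc, an, as, t : ℕ → ℝ be sequences such that for every k: (i) xc k − x k ≥ (v k)²/(2B) (environment test); (ii) −m ≤ an k ≤ A; (iii) as k = an k if either (v k + an k·T ≥ 0 and xc k − x k ≥ v k·T + an k·T²/2 + (v k + an k·T)²/(2B)) or (v k + an k·T < 0 and xc k − x k ≥ −(v k)²/(2·an k)), and as k = −B otherwise; (iv) 0 ≤ t k ≤ T; (v) v k + as k·s ≥ 0 for all s ∈ [0, t k]; (vi) x (k+1) = x k + v k·(t k) + as k·(t k)²/2 and v (k+1) = v k + as k·(t k). Then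 for every k and every s ∈ [0, t k], if x k + v k·s + as k·s²/2 ≥ xc k then v k + as k·s = 0. -/
/-- Displacement under constant acceleration, written with the initial and the current velocity. -/
lemma two_mul_accel_mul_displacement (v a s : ℝ) :
    2 * a * (v * s + a * s ^ 2 / 2) = (v + a * s) ^ 2 - v ^ 2 := by
  ring

/-- If the remaining distance `d` is at least the full stopping distance `v ^ 2 / (2 * b)` of
braking with magnitude `b`, then `d` is covered only once the vehicle stands still. -/
lemma velocity_eq_zero_of_braking {b v d s : ℝ} (hb : 0 < b) (hd : v ^ 2 / (2 * b) ≤ d)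
    (hs : d ≤ v * s + -b * s ^ 2 / 2) : v + -b * s = 0 := by
  have h : v ^ 2 ≤ (v * s + -b * s ^ 2 / 2) * (2 * b) :=
    (div_le_iff₀ (by positivity)).1 (hd.trans hs)
  have hdisp := two_mul_accel_mul_displacement v (-b) s
  exact pow_eq_zero_iff two_ne_zero |>.1 (le_antisymm (by linarith) (sq_nonneg _))

/-- If the remaining distance `d` allows stopping with braking magnitude `B` both immediately and
after accelerating by `a` for time `T`, then within that time `d` is covered only at velocity
zero. -/
lemma velocity_eq_zero_of_stoppable {B v a d s T : ℝ} (hB : 0 < B) (hs0 : 0 ≤ s) (hsT : s ≤ T)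
    (hv : 0 ≤ v) (hvs : 0 ≤ v + a * s) (hvT : 0 ≤ v + a * T)
    (hd : v ^ 2 / (2 * B) ≤ d)
    (hdT : v * T + a * T ^ 2 / 2 + (v + a * T) ^ 2 / (2 * B) ≤ d)
    (hs : d ≤ v * s + a * s ^ 2 / 2) : v + a * s = 0 := by
  have hd' : v ^ 2 ≤ d * (2 * B) := (div_le_iff₀ (by positivity)).1 hd
  have hdT' : (v + a * T) ^ 2 ≤ (d - (v * T + a * T ^ 2 / 2)) * (2 * B) :=
    (div_le_iff₀ (by positivity)).1 (by linarith)
  have hs' := mul_le_mul_of_nonneg_right hs (by positivity : 0 ≤ 2 * B)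
  refine pow_eq_zero_iff two_ne_zero |>.1 (le_antisymm ?_ (sq_nonneg _))
  rcases le_total 0 (B + a) with h | h
  · have := mul_nonneg (mul_nonneg (sub_nonneg.2 hsT) (add_nonneg hvs hvT)) h
    linarith
  · have := mul_nonneg (mul_nonneg hs0 (add_nonneg hv hvs)) (neg_nonneg.2 h)
    linarith

theorem model3_safe (B A m T : ℝ) (hB : 0 < B) (hA : 0 < A) (hm : 0 < m) (hT : 0 < T)
    (x v xc an as t : ℕ → ℝ)
    (henv : ∀ k, xc k - x k ≥ (v k) ^ 2 / (2 * B))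
    (han : ∀ k, -m ≤ an k ∧ an k ≤ A)
    (hctrl : ∀ k,
      ((v k + an k * T ≥ 0 ∧
          xc k - x k ≥ v k * T + an k * T ^ 2 / 2 + (v k + an k * T) ^ 2 / (2 * B)) ∨
        (v k + an k * T < 0 ∧ xc k - x k ≥ -(v k) ^ 2 / (2 * an k)) →
        as k = an k) ∧
      (¬ ((v k + an k * T ≥ 0 ∧
          xc k - x k ≥ v k * T + an k * T ^ 2 / 2 + (v k + an k * T) ^ 2 / (2 * B)) ∨
        (v k + an k * T < 0 ∧ xc k - x k ≥ -(v k) ^ 2 / (2 * an k))) →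
        as k = -B))
    (ht : ∀ k, 0 ≤ t k ∧ t k ≤ T)
    (hvel : ∀ k, ∀ s ∈ Set.Icc (0 : ℝ) (t k), v k + as k * s ≥ 0)
    (hx : ∀ k, x (k + 1) = x k + v k * t k + as k * (t k) ^ 2 / 2)
    (hv : ∀ k, v (k + 1) = v k + as k * t k) :
    ∀ k, ∀ s ∈ Set.Icc (0 : ℝ) (t k),
      x k + v k * s + as k * s ^ 2 / 2 ≥ xc k → v k + as k * s = 0 := by
  intro k s hs hpos
  obtain ⟨hs0, hst⟩ := hs
  have hsT : s ≤ T := hst.trans (ht k).2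
  have hv0 : 0 ≤ v k := by simpa using hvel k 0 ⟨le_rfl, (ht k).1⟩
  have hvs : 0 ≤ v k + as k * s := hvel k s ⟨hs0, hst⟩
  have hcover : xc k - x k ≤ v k * s + as k * s ^ 2 / 2 := by linarith
  by_cases hsafe : (v k + an k * T ≥ 0 ∧
      xc k - x k ≥ v k * T + an k * T ^ 2 / 2 + (v k + an k * T) ^ 2 / (2 * B)) ∨
    (v k + an k * T < 0 ∧ xc k - x k ≥ -(v k) ^ 2 / (2 * an k))
  · rw [(hctrl k).1 hsafe] at hvs hcover ⊢
    rcases hsafe with ⟨hvT, hdT⟩ | ⟨hvT, hd⟩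
    · exact velocity_eq_zero_of_stoppable hB hs0 hsT hv0 hvs hvT (henv k) hdT hcover
    · have han_neg : an k < 0 := by
        by_contra! h
        linarith [mul_nonneg h hT.le]
      have hd' : v k ^ 2 / (2 * -an k) ≤ xc k - x k := by
        rwa [mul_neg, div_neg, ← neg_div]
      simpa using velocity_eq_zero_of_braking (s := s) (neg_pos.2 han_neg) hd' (by simpa using hcover)
  · rw [(hctrl k).2 hsafe] at hcover ⊢
    exact velocity_eq_zero_of_braking hB (henv k) hcover
end

section
/- Let B, A, m, T be real numbers with B > 0, A > 0, m > 0, T > 0, and let x, v, xc, an, as : ℕ → ℝ be sequences such that for every k: (i) xc k − x k ≥ (v k)²/(2B); (ii) −m ≤ an k ≤ A; (iii) as k = an k if xc k − x k ≥ v k·T + an k·T²/2 + (v k + an k·T)²/(2B) (the naive permissive test without case split), and as k = −B otherwise; (iv) v k + as k·s ≥ 0 for all s ∈ [0, T] (the run survives the full interval); (v) x (k+1) = x k + v k·T + as k·T²/2 and v (k+1) = v k + as k·T (the plant evolves for exactly duration T). Then for every k, if x (k+1) ≥ xc k then v (k+1) = 0, and moreover xc k − x (k+1) ≥ (v (k+1))²/(2B).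 -/
theorem naive_test_safe_at_sampling_instants (B A m T : ℝ)
    (hB : 0 < B) (hA : 0 < A) (hm : 0 < m) (hT : 0 < T)
    (x v xc an as : ℕ → ℝ)
    (henv : ∀ k, xc k - x k ≥ (v k) ^ 2 / (2 * B))
    (han : ∀ k, -m ≤ an k ∧ an k ≤ A)
    (hctrl : ∀ k,
      (xc k - x k ≥ v k * T + an k * T ^ 2 / 2 + (v k + an k * T) ^ 2 / (2 * B) →
        as k = an k) ∧
      (¬ (xc k - x k ≥ v k * T + an k * T ^ 2 / 2 + (v k + an k * T) ^ 2 / (2 * B)) →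
        as k = -B))
    (hvel : ∀ k, ∀ s ∈ Set.Icc (0 : ℝ) T, v k + as k * s ≥ 0)
    (hx : ∀ k, x (k + 1) = x k + v k * T + as k * T ^ 2 / 2)
    (hv : ∀ k, v (k + 1) = v k + as k * T) :
    ∀ k, (x (k + 1) ≥ xc k → v (k + 1) = 0) ∧
      xc k - x (k + 1) ≥ (v (k + 1)) ^ 2 / (2 * B) := by
  intro k
  have hgap : xc k - x (k + 1) ≥ (v (k + 1)) ^ 2 / (2 * B) := by
    rw [hx k, hv k]
    by_cases htest :
        xc k - x k ≥ v k * T + an k * T ^ 2 / 2 + (v k + an k * T) ^ 2 / (2 * B)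
    · rw [(hctrl k).1 htest]
      linarith
    · rw [(hctrl k).2 htest]
      have hbrake : (v k + -B * T) ^ 2 / (2 * B)
          = (v k) ^ 2 / (2 * B) - v k * T + B * T ^ 2 / 2 := by
        field_simp
        ring
      linarith [henv k]
  refine ⟨fun hpast => ?_, hgap⟩
  have hquot : (v (k + 1)) ^ 2 / (2 * B) ≤ 0 := by linarith
  have hsq : (v (k + 1)) ^ 2 ≤ 0 := by
    rwa [div_le_iff₀ (by positivity), zero_mul] at hquot
  exact pow_eq_zero_iff two_ne_zero |>.mp (le_antisymm hsq (sq_nonneg _))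
end

section
/- Let B, A, m, T be real numbers with B > 0, A > 0, m > 0, T > 0, and let x, v, xc, vc, an, as, t : ℕ → ℝ be sequences such that for every k: (i) vc k ≥ 0 and xc k − x k ≥ ((v k)² − (vc k)²)/(2B) (environment test); (ii) −m ≤ an k ≤ A; (iii) as k = an k if either (v k + an k·T ≥ 0 and xc k − x k ≥ v k·T + an k·T²/2 + ((v k + an k·T)² − (vc k)²)/(2B)) or (v k + an k·T < 0 and xc k − x k ≥ −(v k)²/(2·an k)), and as k = −B otherwise; (iv) 0 ≤ t k ≤ T; (v) v k + as k·s ≥ 0 for all s ∈ [0, t k]; (vi) x (k+1) = x k + v k·(t k) + as k·(t k)²/2 and v (k+1) = v k + as k·(t k). Then for every k and every s ∈ [0, t k], if x k + v k·s + as k·s²/2 ≥ xc k then v k + as k·s ≤ vc k. -/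
/-- If braking at rate `B` suffices to slow from `v` to `c` before the distance `d`, then braking
at least as hard as `B` keeps the speed at most `c` at or beyond `d`. -/
theorem speed_le_of_brake {B a v c d s : ℝ} (hB : 0 < B) (ha : a ≤ -B) (hc : 0 ≤ c)
    (hv : 0 ≤ v) (hs : 0 ≤ s) (hw : 0 ≤ v + a * s)
    (hd : (v ^ 2 - c ^ 2) / (2 * B) ≤ d) (hx : d ≤ v * s + a * s ^ 2 / 2) :
    v + a * s ≤ c := by
  have h := (div_le_iff₀ (by positivity)).1 (hd.trans hx)
  have hp : 0 ≤ (-B - a) * (s * (v + (v + a * s))) :=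
    mul_nonneg (by linarith) (by positivity)
  exact le_of_abs_le (abs_le_of_sq_le_sq (by linarith) hc)

/-- If the speed is still nonnegative at time `T` and braking at rate `B` from then on suffices to
slow to `c` before the distance `d`, then an acceleration at least `-B` keeps the speed at most `c`
at or beyond `d` during the interval `[0, T]`. -/
theorem speed_le_of_accel {B a v c d s T : ℝ} (hB : 0 < B) (ha : -B ≤ a) (hc : 0 ≤ c)
    (hs : s ≤ T) (hw : 0 ≤ v + a * s) (hu : 0 ≤ v + a * T)
    (hd : v * T + a * T ^ 2 / 2 + ((v + a * T) ^ 2 - c ^ 2) / (2 * B) ≤ d)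
    (hx : d ≤ v * s + a * s ^ 2 / 2) :
    v + a * s ≤ c := by
  have h := (div_le_iff₀ (by positivity)).1 (le_sub_iff_add_le'.2 (hd.trans hx))
  have hp : 0 ≤ (B + a) * ((T - s) * ((v + a * s) + (v + a * T))) :=
    mul_nonneg (by linarith) (mul_nonneg (by linarith) (by linarith))
  exact le_of_abs_le (abs_le_of_sq_le_sq (by linarith) hc)

/-- A vehicle decelerating at rate `-a` stands still at or beyond its stopping distance. -/
theorem speed_eq_zero_of_stop {a v d s : ℝ} (ha : a < 0)
    (hd : -v ^ 2 / (2 * a) ≤ d) (hx : d ≤ v * s + a * s ^ 2 / 2) :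
    v + a * s = 0 := by
  have h := (div_le_iff_of_neg (by linarith)).1 (hd.trans hx)
  exact pow_eq_zero_iff two_ne_zero |>.1 (le_antisymm (by linarith) (sq_nonneg _))

theorem model4_safe (B A m T : ℝ) (hB : 0 < B) (hA : 0 < A) (hm : 0 < m) (hT : 0 < T)
    (x v xc vc an as t : ℕ → ℝ)
    (henv : ∀ k, vc k ≥ 0 ∧ xc k - x k ≥ ((v k) ^ 2 - (vc k) ^ 2) / (2 * B))
    (han : ∀ k, -m ≤ an k ∧ an k ≤ A)
    (hctrl : ∀ k,
      ((v k + an k * T ≥ 0 ∧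
          xc k - x k ≥
            v k * T + an k * T ^ 2 / 2 + ((v k + an k * T) ^ 2 - (vc k) ^ 2) / (2 * B)) ∨
        (v k + an k * T < 0 ∧ xc k - x k ≥ -(v k) ^ 2 / (2 * an k)) →
        as k = an k) ∧
      (¬ ((v k + an k * T ≥ 0 ∧
          xc k - x k ≥
            v k * T + an k * T ^ 2 / 2 + ((v k + an k * T) ^ 2 - (vc k) ^ 2) / (2 * B)) ∨
        (v k + an k * T < 0 ∧ xc k - x k ≥ -(v k) ^ 2 / (2 * an k))) →
        as k = -B))
    (ht : ∀ k, 0 ≤ t k ∧ t k ≤ T)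
    (hvel : ∀ k, ∀ s ∈ Set.Icc (0 : ℝ) (t k), v k + as k * s ≥ 0)
    (hx : ∀ k, x (k + 1) = x k + v k * t k + as k * (t k) ^ 2 / 2)
    (hv : ∀ k, v (k + 1) = v k + as k * t k) :
    ∀ k, ∀ s ∈ Set.Icc (0 : ℝ) (t k),
      x k + v k * s + as k * s ^ 2 / 2 ≥ xc k → v k + as k * s ≤ vc k := by
  intro k s hs hpos
  obtain ⟨hc, hd⟩ := henv k
  have hw := hvel k s hs
  have hv0 : 0 ≤ v k := by simpa using hvel k 0 ⟨le_rfl, (ht k).1⟩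
  have hx' : xc k - x k ≤ v k * s + as k * s ^ 2 / 2 := by linarith
  have hsT : s ≤ T := hs.2.trans (ht k).2
  by_cases hbrake : as k ≤ -B
  · exact speed_le_of_brake hB hbrake hc hv0 hs.1 hw hd hx'
  by_cases hsafe : (v k + an k * T ≥ 0 ∧
          xc k - x k ≥
            v k * T + an k * T ^ 2 / 2 + ((v k + an k * T) ^ 2 - (vc k) ^ 2) / (2 * B)) ∨
        (v k + an k * T < 0 ∧ xc k - x k ≥ -(v k) ^ 2 / (2 * an k))
  · have has := (hctrl k).1 hsafe
    rw [← has] at hsafe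
    obtain ⟨hu, hmsd⟩ | ⟨hu, hmsd⟩ := hsafe
    · exact speed_le_of_accel hB (not_le.1 hbrake).le hc hsT hw hu hmsd hx'
    · have hneg : as k < 0 := by
        by_contra! h
        exact hu.not_ge (by positivity)
      exact (speed_eq_zero_of_stop hneg hmsd hx').trans_le hc
  · exact absurd ((hctrl k).2 hsafe).le hbrake
end

section
/- Let B, v, x, xc, a_s be real numbers with B > 0, v ≥ 0, xc > x, and −B ≤ a_s ≤ −v²/(2·(xc − x)). Then for every t ≥ 0 such that v + a_s·s ≥ 0 for all s ∈ [0, t], it holds that (v + a_s·t)² ≤ 2B·(xc − (x + v·t + a_s·t²/2)); in particular, if x + v·t + a_s·t²/2 ≥ xc then v + a_s·t = 0. -/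
theorem nondeterministic_intervention_safe (B v x xc a_s : ℝ)
    (hB : 0 < B) (hv : 0 ≤ v) (hx : xc > x)
    (has_lb : -B ≤ a_s) (has_ub : a_s ≤ -v ^ 2 / (2 * (xc - x))) :
    ∀ t, 0 ≤ t → (∀ s ∈ Set.Icc (0 : ℝ) t, v + a_s * s ≥ 0) →
      (v + a_s * t) ^ 2 ≤ 2 * B * (xc - (x + v * t + a_s * t ^ 2 / 2)) ∧
      (x + v * t + a_s * t ^ 2 / 2 ≥ xc → v + a_s * t = 0) := by
  intro t _ _
  have hD : 0 < xc - x := sub_pos.mpr hx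
  have hreq : a_s * (2 * (xc - x)) ≤ -v ^ 2 := (le_div_iff₀ (by positivity)).mp has_ub
  have ha : a_s ≤ 0 := by
    by_contra! h
    nlinarith [mul_pos h hD, sq_nonneg v]
  have hw : (v + a_s * t) ^ 2 ≤ -a_s * (2 * (xc - (x + v * t + a_s * t ^ 2 / 2))) := by
    linear_combination hreq
  have hdist : 0 ≤ xc - (x + v * t + a_s * t ^ 2 / 2) := by
    rcases ha.lt_or_eq with h | rfl
    · have := nonneg_of_mul_nonneg_right ((sq_nonneg _).trans hw) (neg_pos.mpr h)
      linarith
    · have hv0 : v = 0 := by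
        have : v ^ 2 ≤ 0 := by linarith
        exact pow_eq_zero_iff two_ne_zero |>.mp (le_antisymm this (sq_nonneg v))
      subst hv0
      linarith
  have hinv : (v + a_s * t) ^ 2 ≤ 2 * B * (xc - (x + v * t + a_s * t ^ 2 / 2)) := by
    nlinarith [mul_nonneg (neg_le_iff_add_nonneg.mp has_lb) hdist]
  refine ⟨hinv, fun hge => ?_⟩
  have hzero : xc - (x + v * t + a_s * t ^ 2 / 2) = 0 := le_antisymm (by linarith) hdist
  rw [hzero, mul_zero] at hinv
  exact pow_eq_zero_iff two_ne_zero |>.mp (le_antisymm hinv (sq_nonneg _))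
end
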